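/- Let P be a simple polygon and let a, b, u, v, w be five distinct points in the interior of P such that {a, b, u, v, w} together with the vertices of P is in strong general position. If the triples (a,b,u), (a,b,v), (a,b,w), (a,u,v) and (a,v,w) are each in geodesic counterclockwise order with respect to P, then the triple (a,u,w) is in geodesic counterclockwise order with respect to P. -/

import Mathlib

open scoped RealInnerProductSpace ENNReal Classical

noncomputable section

/-- Points of the Euclidean plane. -/
abbrev Pt : Type := EuclideanSpace ℝ (Fin 2)

/-- The planar determinant `det (u, v)` of two vectors. -/
def det2 (u v : Pt) : ℝ := u 0 * v 1 - u 1 * v 0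

/-- No three of the points of `S` are collinear. -/
def NoThreeCollinear (S : Set Pt) : Prop :=
  ∀ p ∈ S, ∀ q ∈ S, ∀ r ∈ S, p ≠ q → p ≠ r → q ≠ r → det2 (q - p) (r - p) ≠ 0

/-- `S` is in strong general position: no three points are collinear and for any four
distinct points `p₁ p₂ p₃ p₄` the line through `p₁,p₂` is not parallel to the line
through `p₃,p₄`. -/
def StrongGenPos (S : Set Pt) : Prop :=
  NoThreeCollinear S ∧
    ∀ p₁ ∈ S, ∀ p₂ ∈ S, ∀ p₃ ∈ S, ∀ p₄ ∈ S,
      p₁ ≠ p₂ → p₁ ≠ p₃ → p₁ ≠ p₄ → p₂ ≠ p₃ → p₂ ≠ p₄ → p₃ ≠ p₄ →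
        det2 (p₂ - p₁) (p₄ - p₃) ≠ 0

/-- A simple polygon, given by a cyclic sequence of `n ≥ 3` distinct vertices
(encoded as an `n`-periodic function `ℕ → Pt`), such that no point of the plane lies on
more than two closed edges, and the only points lying on exactly two edges are vertices. -/
structure SimplePolygon where
  n : ℕ
  three_le : 3 ≤ n
  vtx : ℕ → Pt
  periodic : ∀ i, vtx (i + n) = vtx i
  inj : ∀ i < n, ∀ j < n, vtx i = vtx j → i = j
  simple : ∀ x : Pt, {i | i < n ∧ x ∈ segment ℝ (vtx i) (vtx (i + 1))}.ncard ≤ 2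
  vtx_of_two : ∀ x : Pt,
    {i | i < n ∧ x ∈ segment ℝ (vtx i) (vtx (i + 1))}.ncard = 2 → ∃ i < n, x = vtx i

namespace SimplePolygon

/-- The boundary of a simple polygon: the union of its closed edges. -/
def boundary (P : SimplePolygon) : Set Pt :=
  ⋃ i ∈ Finset.range P.n, segment ℝ (P.vtx i) (P.vtx (i + 1))

/-- The interior of a simple polygon: the union of the bounded connected components of the
complement of the boundary. -/
def interior (P : SimplePolygon) : Set Pt :=
  {x | x ∉ P.boundary ∧ Bornology.IsBounded (connectedComponentIn P.boundaryᶜ x)}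

/-- A simple polygon, regarded as a point set: boundary together with interior. -/
def region (P : SimplePolygon) : Set Pt := P.boundary ∪ P.interior

/-- The set of vertices of the polygon. -/
def vertexSet (P : SimplePolygon) : Set Pt := {x | ∃ i < P.n, x = P.vtx i}

/-- Twice the shoelace signed area. -/
def shoelace (P : SimplePolygon) : ℝ := ∑ i ∈ Finset.range P.n, det2 (P.vtx i) (P.vtx (i + 1))

/-- The vertices are listed in counterclockwise order (positive shoelace signed area). -/
def CCW (P : SimplePolygon) : Prop := 0 < P.shoelace

/-- The vertex `vtx (i+1)` is a convex vertex:
`det (v_{i+1} − v_i, v_{i+2} − v_{i+1}) > 0` (vertices listed counterclockwise). -/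
def ConvexAt (P : SimplePolygon) (i : ℕ) : Prop :=
  0 < det2 (P.vtx (i + 1) - P.vtx i) (P.vtx (i + 2) - P.vtx (i + 1))

/-- The number of convex vertices of the polygon. -/
def numConvex (P : SimplePolygon) : ℕ := {i | i < P.n ∧ P.ConvexAt i}.ncard

/-- Continuous paths from `s` to `t` staying inside the polygon. -/
def pathsIn (P : SimplePolygon) (s t : Pt) : Set (ℝ → Pt) :=
  {γ | ContinuousOn γ (Set.Icc 0 1) ∧ γ 0 = s ∧ γ 1 = t ∧ γ '' Set.Icc (0 : ℝ) 1 ⊆ P.region}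

/-- The geodesic distance between `s` and `t` inside the polygon: the infimum of the
lengths (total variations) of continuous paths in the polygon from `s` to `t`. -/
def geodDist (P : SimplePolygon) (s t : Pt) : ℝ≥0∞ :=
  ⨅ γ ∈ P.pathsIn s t, eVariationOn γ (Set.Icc 0 1)

end SimplePolygon

/-- Length of a polygonal path through a list of points. -/
def polylineLen : List Pt → ℝ
  | [] => 0
  | [_] => 0
  | a :: b :: l => dist a b + polylineLen (b :: l)

/-- The polygonal path through a list of points, as a point set. -/
def polylineSet : List Pt → Set Pt
  | [] => ∅
  | [a] => {a}
  | a :: b :: l => segment ℝ a b ∪ polylineSet (b :: l)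

/-- `L` is the vertex sequence of the geodesic from `s` to `t` inside the polygon `P`:
a polygonal path inside `P` from `s` to `t`, with consecutive vertices distinct, with no
three consecutive vertices collinear, whose length realizes the geodesic distance. -/
def SimplePolygon.IsGeodesicChain (P : SimplePolygon) (s t : Pt) (L : List Pt) : Prop :=
  L.head? = some s ∧ L.getLast? = some t ∧ List.Chain' (· ≠ ·) L ∧
  (∀ i, i + 2 < L.length →
      det2 (L.getD (i + 1) 0 - L.getD i 0) (L.getD (i + 2) 0 - L.getD i 0) ≠ 0) ∧
  polylineSet L ⊆ P.region ∧
  ENNReal.ofReal (polylineLen L) = P.geodDist s t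

/-- The triple `(p,q,r)` is in geodesic counterclockwise order with respect to `P`:
writing the geodesics `π(p,q) = ⟨p = v₀, …, v_k = q⟩` and `π(p,r) = ⟨p = u₀, …, u_{k'} = r⟩`
and taking the smallest index `i > 0` with `v_i ≠ u_i`, we have
`det (v_i − v_{i−1}, u_i − v_{i−1}) > 0`. -/
def geodesicCCW (P : SimplePolygon) (p q r : Pt) : Prop :=
  ∃ L M : List Pt, P.IsGeodesicChain p q L ∧ P.IsGeodesicChain p r M ∧
    ∃ i : ℕ, 0 < i ∧ (∀ j < i, L[j]? = M[j]?) ∧ L[i]? ≠ M[i]? ∧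
      ∃ a b c : Pt, L[i - 1]? = some a ∧ L[i]? = some b ∧ M[i]? = some c ∧
        0 < det2 (b - a) (c - a)

/-- The triple `(p,q,r)` is in geodesic clockwise order with respect to `P`. -/
def geodesicCW (P : SimplePolygon) (p q r : Pt) : Prop :=
  ∃ L M : List Pt, P.IsGeodesicChain p q L ∧ P.IsGeodesicChain p r M ∧
    ∃ i : ℕ, 0 < i ∧ (∀ j < i, L[j]? = M[j]?) ∧ L[i]? ≠ M[i]? ∧
      ∃ a b c : Pt, L[i - 1]? = some a ∧ L[i]? = some b ∧ M[i]? = some c ∧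
        det2 (b - a) (c - a) < 0

/-- `C ⊆ P` is geodesically convex: for all `p, q ∈ C` the geodesic connecting them
stays inside `C`. -/
def GeodesicallyConvex (P : SimplePolygon) (C : Set Pt) : Prop :=
  C ⊆ P.region ∧ ∀ p ∈ C, ∀ q ∈ C, ∀ L, P.IsGeodesicChain p q L → polylineSet L ⊆ C

/-- The geodesic hull `CH_P(U)`: the intersection of all geodesically convex subsets of `P`
containing `U`. -/
def geodesicHull (P : SimplePolygon) (U : Set Pt) : Set Pt :=
  ⋂₀ {C | GeodesicallyConvex P C ∧ U ⊆ C}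

/-- `E_P(S)`: the set of points of `S` lying on the (topological) boundary of the geodesic
hull of `S` with respect to `P`. -/
def extremeSet (P : SimplePolygon) (S : Set Pt) : Set Pt :=
  {x ∈ S | x ∈ frontier (geodesicHull P S)}

/-- `B` is separable from `R`: there is a simple polygon with at most `|B|` convex vertices
whose interior contains all points of `R` and which contains no point of `B`. -/
def Separable (B R : Finset Pt) : Prop :=
  ∃ P : SimplePolygon, P.CCW ∧ P.numConvex ≤ B.card ∧
    (∀ r ∈ R, r ∈ P.interior) ∧ ∀ b ∈ B, b ∉ P.region

/-! ### Sums over the edges of a polygonal path -/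

/-- The sum of `g` over the edges of a polygonal path. -/
def edgeSum (g : Pt → Pt → ℝ) : List Pt → ℝ
  | [] => 0
  | [_] => 0
  | a :: b :: l => g a b + edgeSum g (b :: l)

lemma polylineLen_eq_edgeSum (L : List Pt) : polylineLen L = edgeSum dist L := by
  induction L with
  | nil => rfl
  | cons a l ih =>
    cases l with
    | nil => rfl
    | cons b l => simp only [polylineLen, edgeSum, ih]

lemma edgeSum_append (g : Pt → Pt → ℝ) (A : List Pt) (x : Pt) (B : List Pt) :
    edgeSum g (A ++ x :: B) = edgeSum g (A ++ [x]) + edgeSum g (x :: B) := by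
  induction A with
  | nil => simp [edgeSum]
  | cons a A ih =>
    cases A with
    | nil => simp [edgeSum]
    | cons b A =>
      simp only [List.cons_append, edgeSum] at ih ⊢
      rw [ih]; ring

lemma polylineLen_append (A : List Pt) (x : Pt) (B : List Pt) :
    polylineLen (A ++ x :: B) = polylineLen (A ++ [x]) + polylineLen (x :: B) := by
  simp only [polylineLen_eq_edgeSum, edgeSum_append dist A x B]

lemma polylineLen_nonneg (L : List Pt) : 0 ≤ polylineLen L := by
  induction L with
  | nil => simp [polylineLen]
  | cons a l ih =>
    cases l with
    | nil => simp [polylineLen]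
    | cons b l => simp only [polylineLen]; positivity

lemma mem_polylineSet_cons (a : Pt) (l : List Pt) : a ∈ polylineSet (a :: l) := by
  cases l with
  | nil => simp [polylineSet]
  | cons b l => exact Or.inl (left_mem_segment ℝ a b)

lemma polylineSet_append (A : List Pt) (x : Pt) (B : List Pt) :
    polylineSet (A ++ x :: B) = polylineSet (A ++ [x]) ∪ polylineSet (x :: B) := by
  induction A with
  | nil =>
    simp [polylineSet, Set.insert_eq_of_mem (mem_polylineSet_cons x B)]
  | cons a A ih =>
    cases A with
    | nil =>
      have : x ∈ polylineSet (x :: B) := mem_polylineSet_cons x B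
      ext z
      simp only [List.cons_append, List.nil_append, polylineSet, Set.mem_union,
        Set.mem_singleton_iff]
      constructor
      · tauto
      · rintro ((h | rfl) | h) <;> tauto
    | cons b A =>
      simp only [List.cons_append, polylineSet] at ih ⊢
      rw [ih, Set.union_assoc]

lemma mem_polylineSet_of_mem {x : Pt} {L : List Pt} (h : x ∈ L) : x ∈ polylineSet L := by
  obtain ⟨A, B, rfl⟩ := List.append_of_mem h
  rw [polylineSet_append]
  exact Or.inr (mem_polylineSet_cons x B)

lemma segment_subset_polylineSet (A : List Pt) (p q : Pt) (B : List Pt) :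
    segment ℝ p q ⊆ polylineSet (A ++ p :: q :: B) := by
  rw [polylineSet_append]
  exact fun z hz => Or.inr (Or.inl hz)

/-! ### Shortest polygonal paths in a planar set -/

/-- A reduced shortest polygonal path in `K` from `s` to `t`. -/
structure IsShortest (K : Set Pt) (s t : Pt) (L : List Pt) : Prop where
  head : L.head? = some s
  last : L.getLast? = some t
  ne : ∀ A p q B, L = A ++ p :: q :: B → p ≠ q
  bend : ∀ A p x q B, L = A ++ p :: x :: q :: B → det2 (x - p) (q - p) ≠ 0
  subset : polylineSet L ⊆ K
  le : ∀ N : List Pt, N.head? = some s → N.getLast? = some t → polylineSet N ⊆ K →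
    polylineLen L ≤ polylineLen N

namespace IsShortest

variable {K : Set Pt} {s t : Pt}

lemma prefix_shortest {A : List Pt} {x : Pt} {B : List Pt}
    (h : IsShortest K s t (A ++ x :: B)) : IsShortest K s x (A ++ [x]) where
  head := by have := h.head; cases A <;> simpa using this
  last := by simp
  ne C p q D e := h.ne C p q (D ++ B) (by
    have : A ++ x :: B = (A ++ [x]) ++ B := by simp
    rw [this, e]; simp)
  bend C p y q D e := h.bend C p y q (D ++ B) (by
    have : A ++ x :: B = (A ++ [x]) ++ B := by simp
    rw [this, e]; simp)
  subset := by
    have := h.subset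
    rw [polylineSet_append] at this
    exact fun z hz => this (Or.inl hz)
  le N hN hN' hK := by
    obtain ⟨N, rfl⟩ := List.getLast?_eq_some_iff.1 hN'
    have h2 := h.subset
    rw [polylineSet_append] at h2
    have := h.le (N ++ x :: B) (by cases N <;> simpa using hN)
      (by have := h.last; simp at this ⊢; exact this)
      (by rw [polylineSet_append]; exact Set.union_subset hK fun z hz => h2 (Or.inr hz))
    rw [polylineLen_append A, polylineLen_append N] at this
    linarith

lemma suffix_shortest {A : List Pt} {x : Pt} {B : List Pt}
    (h : IsShortest K s t (A ++ x :: B)) : IsShortest K x t (x :: B) where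
  head := by simp
  last := by have := h.last; simp at this ⊢; exact this
  ne C p q D e := h.ne (A ++ C) p q D (by rw [e]; simp)
  bend C p y q D e := h.bend (A ++ C) p y q D (by rw [e]; simp)
  subset := by
    have := h.subset
    rw [polylineSet_append] at this
    exact fun z hz => this (Or.inr hz)
  le N hN hN' hK := by
    obtain ⟨N, rfl⟩ := List.head?_eq_some_iff.1 hN
    have h2 := h.subset
    rw [polylineSet_append] at h2
    have := h.le (A ++ x :: N) (by have := h.head; cases A <;> simpa using this)
      (by simp at hN' ⊢; exact hN')
      (by rw [polylineSet_append]; exact Set.union_subset (fun z hz => h2 (Or.inl hz)) hK)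
    rw [polylineLen_append A x B, polylineLen_append A x N] at this
    linarith

lemma nodup {L : List Pt} (h : IsShortest K s t L) : L.Nodup := by
  by_contra hd
  obtain ⟨x, hx⟩ := List.exists_duplicate_iff_not_nodup.2 hd
  obtain ⟨A, L', rfl, hL'⟩ : ∃ A L', L = A ++ x :: L' ∧ x ∈ L' := by
    clear h hd
    induction L with
    | nil => simp at hx
    | cons a l ih =>
      rcases List.duplicate_cons_iff.1 hx with ⟨rfl, h⟩ | h
      · exact ⟨[], l, rfl, h⟩
      · obtain ⟨A, L', rfl, h'⟩ := ih h
        exact ⟨a :: A, L', rfl, h'⟩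
  have h1 := h.suffix_shortest
  obtain ⟨B, C, rfl⟩ := List.append_of_mem hL'
  have h2 : IsShortest K x x (x :: B ++ [x]) :=
    IsShortest.prefix_shortest (A := x :: B) (B := C) (by simpa using h1)
  have h3 := h2.le [x] (by simp) (by simp) (by
    simpa [polylineSet] using h2.subset (mem_polylineSet_cons x _))
  cases B with
  | nil => exact h2.ne [] x x [] (by simp) rfl
  | cons b B =>
    have h4 := h2.ne [] x b (B ++ [x]) (by simp)
    have h5 := polylineLen_nonneg (b :: (B ++ [x]))
    have h6 := dist_pos.2 h4
    simp only [List.cons_append, polylineLen] at h3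
    linarith

/-- A corner of a shortest path cannot be cut inside `K`. -/
lemma exists_notMem_of_corner {A : List Pt} {p x q : Pt} {B : List Pt}
    (h : IsShortest K s t (A ++ p :: x :: q :: B)) {ε : ℝ} (h0 : 0 < ε) (h1 : ε ≤ 1) :
    ∃ y ∈ segment ℝ (x + ε • (p - x)) (x + ε • (q - x)), y ∉ K := by
  by_contra! hK
  set p' := x + ε • (p - x) with hp'
  set q' := x + ε • (q - x) with hq'
  have hd := h.bend A p x q B rfl
  have hsub := h.subset
  rw [polylineSet_append] at hsub
  have hseg1 : segment ℝ p x ⊆ K := fun z hz => hsub (Or.inr (Or.inl hz))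
  have hseg2 : segment ℝ x q ⊆ K := fun z hz => hsub (Or.inr (Or.inr (Or.inl hz)))
  have hp1 : p' ∈ segment ℝ p x := by
    rw [segment_symm, segment_eq_image']
    exact ⟨ε, ⟨h0.le, h1⟩, rfl⟩
  have hq1 : q' ∈ segment ℝ x q := by
    rw [segment_eq_image']
    exact ⟨ε, ⟨h0.le, h1⟩, rfl⟩
  have hlast := h.last
  have := h.le (A ++ p :: p' :: q' :: q :: B) (by have := h.head; cases A <;> simpa using this)
    (by simp at hlast ⊢; exact hlast)
    (by
      rw [polylineSet_append]
      refine Set.union_subset (fun z hz => hsub (Or.inl hz)) ?_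
      refine Set.union_subset (fun z hz => hseg1 ?_) (Set.union_subset hK
        (Set.union_subset (fun z hz => hseg2 ?_) (fun z hz => hsub (Or.inr (Or.inr (Or.inr hz))))))
      · exact (convex_segment p x).segment_subset (left_mem_segment ℝ _ _) hp1 hz
      · exact (convex_segment x q).segment_subset hq1 (right_mem_segment ℝ _ _) hz)
  rw [polylineLen_append A p (x :: _), polylineLen_append A p (p' :: _)] at this
  simp only [polylineLen] at this
  have d1 : dist p p' + dist p' x = dist p x :=
    dist_add_dist_of_mem_segment hp1
  have d2 : dist x q' + dist q' q = dist x q :=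
    dist_add_dist_of_mem_segment hq1
  have d3 : dist p' x + dist x q' ≤ dist p' q' := by linarith
  have d4 : dist p' x + dist x q' = dist p' q' := le_antisymm d3 (dist_triangle _ _ _)
  have d5 : x ∈ segment ℝ p' q' := mem_segment_iff_wbtw.2 (dist_add_dist_eq_iff.1 d4)
  rw [segment_eq_image'] at d5
  obtain ⟨r, hr, hr'⟩ := d5
  have c0 := congrArg (fun z : Pt => z 0) hr'
  have c1 := congrArg (fun z : Pt => z 1) hr'
  simp [hp', hq'] at c0 c1
  have hε := h0.ne'
  have c0' : (1 - r) * (p 0 - x 0) + r * (q 0 - x 0) = 0 := by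
    apply mul_left_cancel₀ hε; linear_combination c0
  have c1' : (1 - r) * (p 1 - x 1) + r * (q 1 - x 1) = 0 := by
    apply mul_left_cancel₀ hε; linear_combination c1
  have k1 : r * det2 (x - p) (q - p) = 0 := by
    simp only [det2, PiLp.sub_apply]; linear_combination (x 0 - p 0) * c1' - (x 1 - p 1) * c0'
  have k2 : (1 - r) * det2 (x - p) (q - p) = 0 := by
    simp only [det2, PiLp.sub_apply]; linear_combination (x 1 - q 1) * c0' - (x 0 - q 0) * c1'
  rcases mul_eq_zero.1 k1 with rfl | k
  · simp at k2; exact hd k2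
  · exact hd k

end IsShortest

/-! ### Geodesic chains are shortest polygonal paths -/

namespace SimplePolygon

lemma geodDist_self_le (P : SimplePolygon) {a : Pt} (ha : a ∈ P.region) : P.geodDist a a ≤ 0 := by
  refine (iInf₂_le (fun _ => a) ?_).trans (eVariationOn.constant_on ?_).le
  · refine ⟨continuousOn_const, rfl, rfl, ?_⟩
    rintro _ ⟨_, _, rfl⟩
    exact ha
  · rintro _ ⟨_, _, rfl⟩ _ ⟨_, _, rfl⟩
    rfl

lemma geodDist_le_edist_add (P : SimplePolygon) {a b t : Pt} (hab : segment ℝ a b ⊆ P.region) :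
    P.geodDist a t ≤ ENNReal.ofReal (dist a b) + P.geodDist b t := by
  rw [geodDist, geodDist, ENNReal.add_iInf₂]
  refine le_iInf₂ fun γ hγ => ?_
  obtain ⟨hc, h0, h1, hK⟩ := hγ
  set f : ℝ → Pt := fun x => if x ≤ 1 / 2 then AffineMap.lineMap a b (2 * x) else γ (2 * x - 1)
    with hf
  have hf1 : Set.EqOn f (fun x => AffineMap.lineMap a b (2 * x)) (Set.Icc 0 (1 / 2)) :=
    fun x hx => if_pos hx.2
  have hf2 : Set.EqOn f (γ ∘ fun x => 2 * x - 1) (Set.Icc (1 / 2) 1) := by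
    intro x hx
    rcases hx.1.eq_or_lt with rfl | h
    · norm_num [hf, h0]
    · simp only [hf, Function.comp_apply, if_neg (not_le.2 h)]
  have hmaps : Set.MapsTo (fun x : ℝ => 2 * x - 1) (Set.Icc (1 / 2) 1) (Set.Icc 0 1) := by
    intro x hx
    constructor <;> simp only <;> linarith [hx.1, hx.2]
  have hunion : Set.Icc (0 : ℝ) 1 = Set.Icc 0 (1 / 2) ∪ Set.Icc (1 / 2) 1 :=
    (Set.Icc_union_Icc_eq_Icc (by norm_num) (by norm_num)).symm
  have hfmem : f ∈ P.pathsIn a t := by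
    refine ⟨?_, ?_, ?_, ?_⟩
    · rw [hunion]
      refine ContinuousOn.union_of_isClosed ?_ ?_ isClosed_Icc isClosed_Icc
      · refine ContinuousOn.congr ?_ hf1
        exact (AffineMap.lineMap_continuous.comp (by fun_prop)).continuousOn
      · refine ContinuousOn.congr ?_ hf2
        exact hc.comp (by fun_prop) hmaps
    · simp [hf]
    · simp only [hf]
      norm_num [h1]
    · rw [hunion, Set.image_union, hf1.image_eq, hf2.image_eq]
      refine Set.union_subset ?_ ?_
      · rintro _ ⟨x, hx, rfl⟩
        apply hab
        rw [segment_eq_image_lineMap]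
        exact ⟨2 * x, ⟨by linarith [hx.1], by linarith [hx.2]⟩, rfl⟩
      · rintro _ ⟨x, hx, rfl⟩
        exact hK ⟨_, hmaps hx, rfl⟩
  refine (iInf₂_le f hfmem).trans ?_
  · have key := eVariationOn.Icc_add_Icc f (s := Set.univ) (a := 0) (b := 1 / 2) (c := 1)
      (by norm_num) (by norm_num) trivial
    simp only [Set.univ_inter] at key
    rw [← key, eVariationOn.congr hf1, eVariationOn.congr hf2]
    refine add_le_add ?_ (eVariationOn.comp_le_of_monotoneOn γ _ ?_ hmaps)
    · have hm : MonotoneOn (fun x : ℝ => 2 * x) (Set.Icc 0 (1 / 2)) :=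
        fun x _ y _ h => by simpa using h
      have hv := hm.eVariationOn_eq (a := 0) (b := 1 / 2) (by simp) (by simp)
      have hl : LipschitzOnWith (nndist a b) (AffineMap.lineMap a b : ℝ → Pt) Set.univ :=
        (lipschitzWith_lineMap a b).lipschitzOnWith
      have := hl.comp_eVariationOn_le (g := fun x : ℝ => 2 * x) (s := Set.Icc 0 (1 / 2))
        (fun _ _ => trivial)
      refine this.trans ?_
      rw [Set.inter_self] at hv
      rw [hv]
      rw [← edist_dist, edist_nndist]
      norm_num
    · intro x _ y _ h
      simp only
      linarith

lemma geodDist_le_polylineLen (P : SimplePolygon) {t : Pt} (N : List Pt) :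
    ∀ s, N.head? = some s → N.getLast? = some t → polylineSet N ⊆ P.region →
      P.geodDist s t ≤ ENNReal.ofReal (polylineLen N) := by
  induction N with
  | nil => simp
  | cons a l ih =>
    intro s hs ht hK
    obtain rfl : a = s := by simpa using hs
    cases l with
    | nil =>
      obtain rfl : a = t := by simpa using ht
      simpa [polylineLen] using P.geodDist_self_le (hK (mem_polylineSet_cons a []))
    | cons b l =>
      simp only [polylineLen]
      rw [ENNReal.ofReal_add dist_nonneg (polylineLen_nonneg _)]
      refine (P.geodDist_le_edist_add fun z hz => hK (Or.inl hz)).trans ?_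
      gcongr
      exact ih b rfl (by simpa using ht) fun z hz => hK (Or.inr hz)

lemma IsGeodesicChain.isShortest {P : SimplePolygon} {s t : Pt} {L : List Pt}
    (h : P.IsGeodesicChain s t L) : IsShortest P.region s t L := by
  obtain ⟨h1, h2, h3, h4, h5, h6⟩ := h
  refine ⟨h1, h2, ?_, ?_, h5, fun N hN hN' hK => ?_⟩
  · rintro A p q B rfl
    have h3 : List.IsChain (· ≠ ·) (A ++ p :: q :: B) := h3
    rw [List.isChain_split] at h3
    exact (List.isChain_cons_cons.1 h3.2).1
  · rintro A p x q B rfl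
    have := h4 A.length (by simp)
    simpa [List.getD_eq_getElem?_getD, List.getElem?_append_right] using this
  · have := P.geodDist_le_polylineLen N s hN hN' hK
    rw [← h6] at this
    exact (ENNReal.ofReal_le_ofReal_iff (polylineLen_nonneg _)).1 this

end SimplePolygon

/-! ### Angles swept by polygonal paths -/

/-- The oriented angle from `u` to `v`, as a real number in `(-π, π]`. -/
def turn (u v : Pt) : ℝ := Complex.arg ⟨inner ℝ u v, det2 u v⟩

/-- The argument of a plane vector. -/
def direction (u : Pt) : ℝ := Complex.arg ⟨u 0, u 1⟩

lemma inner_eq (u v : Pt) : inner ℝ u v = u 0 * v 0 + u 1 * v 1 := by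
  simp [PiLp.inner_apply, Fin.sum_univ_two, mul_comm]

lemma Pt.ext_coord {u v : Pt} (h0 : u 0 = v 0) (h1 : u 1 = v 1) : u = v := by
  ext i
  fin_cases i
  · exact h0
  · exact h1

lemma turn_coe {u v : Pt} (hu : u ≠ 0) (hv : v ≠ 0) :
    (turn u v : Real.Angle) = direction v - direction u := by
  have key : ∀ w : Pt, w ≠ 0 → (⟨w 0, w 1⟩ : ℂ) ≠ 0 := by
    intro w hw h
    exact hw (Pt.ext_coord (congrArg Complex.re h) (congrArg Complex.im h))
  have e : (⟨inner ℝ u v, det2 u v⟩ : ℂ)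
      = (starRingEnd ℂ) ⟨u 0, u 1⟩ * ⟨v 0, v 1⟩ := by
    apply Complex.ext
    · simp [inner_eq]
    · simp [det2]; ring
  rw [turn, e, Complex.arg_mul_coe_angle ((map_ne_zero _).2 (key u hu)) (key v hv),
    Complex.arg_conj_coe_angle, direction, direction]
  abel

lemma turn_mem_Ioc (u v : Pt) : turn u v ∈ Set.Ioc (-Real.pi) Real.pi :=
  Complex.arg_mem_Ioc _

lemma abs_turn_lt {u v : Pt} (h : 0 < inner ℝ u v) : |turn u v| < Real.pi / 2 :=
  Complex.abs_arg_lt_pi_div_two_iff.2 (Or.inl h)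

lemma ne_zero_of_inner_pos {c u : Pt} (h : 0 < inner ℝ c u) : u ≠ 0 := by
  rintro rfl
  simp at h

/-- Inside an open half-plane, angles are additive. -/
lemma turn_eq_sub {c u v : Pt} (hu : 0 < inner ℝ c u) (hv : 0 < inner ℝ c v) :
    turn u v = turn c v - turn c u := by
  have hc : c ≠ 0 := ne_zero_of_inner_pos (c := u) (by rwa [real_inner_comm])
  have hu0 := ne_zero_of_inner_pos hu
  have hv0 := ne_zero_of_inner_pos hv
  have h : (turn u v : Real.Angle) = (turn c v - turn c u : ℝ) := by
    rw [Real.Angle.coe_sub, turn_coe hu0 hv0, turn_coe hc hv0, turn_coe hc hu0]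
    abel
  have h1 := abs_lt.1 (abs_turn_lt hu)
  have h2 := abs_lt.1 (abs_turn_lt hv)
  have h3 := turn_mem_Ioc u v
  have := congrArg Real.Angle.toReal h
  rwa [Real.Angle.toReal_coe_eq_self_iff.2 h3,
    Real.Angle.toReal_coe_eq_self_iff.2 ⟨by linarith, by linarith⟩] at this

/-- The angle swept, as seen from `y`, by a polygonal path. -/
def sweep (y : Pt) (L : List Pt) : ℝ := edgeSum (fun a b => turn (a - y) (b - y)) L

lemma sweep_eq_of_halfPlane {y c : Pt} (L : List Pt) :
    ∀ s t, L.head? = some s → L.getLast? = some t → (∀ v ∈ L, 0 < inner ℝ c (v - y)) →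
      sweep y L = turn c (t - y) - turn c (s - y) := by
  induction L with
  | nil => simp
  | cons a l ih =>
    intro s t hs ht hpos
    obtain rfl : a = s := by simpa using hs
    cases l with
    | nil =>
      obtain rfl : a = t := by simpa using ht
      simp [sweep, edgeSum]
    | cons b l =>
      have := ih b t rfl (by simpa using ht) fun v hv => hpos v (List.mem_cons_of_mem _ hv)
      simp only [sweep, edgeSum] at this ⊢
      rw [this, turn_eq_sub (hpos a (by simp)) (hpos b (by simp))]
      ring

lemma sweep_coe {y : Pt} (L : List Pt) :
    ∀ s t, L.head? = some s → L.getLast? = some t → (∀ v ∈ L, v ≠ y) →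
      (sweep y L : Real.Angle) = direction (t - y) - direction (s - y) := by
  induction L with
  | nil => simp
  | cons a l ih =>
    intro s t hs ht hne
    obtain rfl : a = s := by simpa using hs
    cases l with
    | nil =>
      obtain rfl : a = t := by simpa using ht
      simp [sweep, edgeSum]
    | cons b l =>
      have := ih b t rfl (by simpa using ht) fun v hv => hne v (List.mem_cons_of_mem _ hv)
      simp only [sweep, edgeSum, Real.Angle.coe_add] at this ⊢
      rw [this, turn_coe (sub_ne_zero.2 (hne a (by simp))) (sub_ne_zero.2 (hne b (by simp)))]
      abel

lemma det2_ne_zero_or_inner_pos {a b y : Pt} (hy : y ∉ segment ℝ a b) :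
    0 < inner ℝ (a - y) (b - y) ∨ det2 (a - y) (b - y) ≠ 0 := by
  by_contra! h
  obtain ⟨h1, h2⟩ := h
  apply hy
  rw [segment_eq_image']
  by_cases hab : inner ℝ (b - a) (b - a) = (0 : ℝ)
  · have : b = a := sub_eq_zero.1 (inner_self_eq_zero.1 hab)
    subst this
    have : b = y := sub_eq_zero.1 (inner_self_eq_zero.1 (le_antisymm h1 real_inner_self_nonneg))
    exact ⟨0, by simp, by simpa using this⟩
  · have hpos : 0 < inner ℝ (b - a) (b - a) := lt_of_le_of_ne real_inner_self_nonneg (Ne.symm hab)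
    have ha := real_inner_self_nonneg (x := a - y)
    have hb := real_inner_self_nonneg (x := b - y)
    refine ⟨inner ℝ (y - a) (b - a) / inner ℝ (b - a) (b - a),
      ⟨div_nonneg ?_ hpos.le, (div_le_one hpos).2 ?_⟩, ?_⟩
    · simp only [inner_eq, PiLp.sub_apply] at *; nlinarith
    · simp only [inner_eq, PiLp.sub_apply] at *; nlinarith
    · have hr := div_mul_cancel₀ (inner ℝ (y - a) (b - a) : ℝ) hab
      set r := (inner ℝ (y - a) (b - a) / inner ℝ (b - a) (b - a) : ℝ)
      simp only [inner_eq, det2, PiLp.sub_apply] at hr h2 hab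
      apply Pt.ext_coord <;> apply mul_right_cancel₀ hab <;>
        simp only [PiLp.sub_apply, PiLp.add_apply, PiLp.smul_apply, smul_eq_mul]
      · linear_combination (b 0 - a 0) * hr + (b 1 - a 1) * h2
      · linear_combination (b 1 - a 1) * hr - (b 0 - a 0) * h2

lemma continuousAt_turn {a b y : Pt} (hy : y ∉ segment ℝ a b) :
    ContinuousAt (fun z => turn (a - z) (b - z)) y := by
  have h : ContinuousAt Complex.arg ⟨inner ℝ (a - y) (b - y), det2 (a - y) (b - y)⟩ :=
    Complex.continuousAt_arg (Complex.mem_slitPlane_iff.2 (det2_ne_zero_or_inner_pos hy))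
  have h2 : Continuous fun z : Pt => (⟨inner ℝ (a - z) (b - z), det2 (a - z) (b - z)⟩ : ℂ) := by
    have : (fun z : Pt => (⟨inner ℝ (a - z) (b - z), det2 (a - z) (b - z)⟩ : ℂ)) = fun z =>
        ((inner ℝ (a - z) (b - z) : ℝ) : ℂ) + (det2 (a - z) (b - z) : ℝ) * Complex.I := by
      funext z
      apply Complex.ext <;> simp
    rw [this]
    have h3 : Continuous fun z : Pt => det2 (a - z) (b - z) := by
      simp only [det2, PiLp.sub_apply]
      fun_prop
    fun_prop
  exact ContinuousAt.comp (f := fun z : Pt =>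
    (⟨inner ℝ (a - z) (b - z), det2 (a - z) (b - z)⟩ : ℂ)) h h2.continuousAt

lemma continuousAt_sweep {y : Pt} (L : List Pt) (hy : y ∉ polylineSet L) :
    ContinuousAt (fun z => sweep z L) y := by
  induction L with
  | nil => exact continuousAt_const
  | cons a l ih =>
    cases l with
    | nil => exact continuousAt_const
    | cons b l =>
      rw [polylineSet, Set.mem_union, not_or] at hy
      exact (continuousAt_turn hy.1).add (ih hy.2)

/-- If two polygonal paths have the same ends and avoid a connected unbounded set `C`, then they
sweep the same angle as seen from any point of `C`. -/
lemma sweep_eq_of_unbounded {L M : List Pt} {s t : Pt} (hL : L.head? = some s)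
    (hL' : L.getLast? = some t) (hM : M.head? = some s) (hM' : M.getLast? = some t)
    {C : Set Pt} (hC : IsPreconnected C) (hCb : ¬ Bornology.IsBounded C)
    (hLC : Disjoint C (polylineSet L)) (hMC : Disjoint C (polylineSet M))
    {y : Pt} (hy : y ∈ C) : sweep y L = sweep y M := by
  set D : Pt → ℝ := fun z => sweep z L - sweep z M with hD
  have hcont : ContinuousOn D C := fun z hz =>
    ((continuousAt_sweep L (Set.disjoint_left.1 hLC hz)).sub
      (continuousAt_sweep M (Set.disjoint_left.1 hMC hz))).continuousWithinAt
  have hper : ∀ z ∈ C, ∃ k : ℤ, k • (2 * Real.pi) = D z := by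
    intro z hz
    rw [← Real.Angle.coe_eq_zero_iff, hD]
    simp only [Real.Angle.coe_sub]
    rw [sweep_coe L s t hL hL', sweep_coe M s t hM hM', sub_self]
    · rintro v hv rfl
      exact Set.disjoint_left.1 hMC hz (mem_polylineSet_of_mem hv)
    · rintro v hv rfl
      exact Set.disjoint_left.1 hLC hz (mem_polylineSet_of_mem hv)
  obtain ⟨z, hzC, hz⟩ : ∃ z ∈ C, D z = 0 := by
    obtain ⟨R, hR⟩ : ∃ R : ℝ, ∀ v ∈ L ++ M, ‖v‖ ≤ R := by
      obtain ⟨R, hR⟩ := ((L ++ M).toFinset.finite_toSet.image fun v : Pt => ‖v‖).bddAbove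
      exact ⟨R, fun v hv => hR ⟨v, by simpa using hv, rfl⟩⟩
    obtain ⟨z, hzC, hz⟩ : ∃ z ∈ C, R < ‖z‖ := by
      by_contra! h
      exact hCb (isBounded_iff_forall_norm_le.2 ⟨R, h⟩)
    have hpos : ∀ v ∈ L ++ M, 0 < inner ℝ (-z) (v - z) := by
      intro v hv
      have h1 := real_inner_le_norm z v
      have h2 := real_inner_self_eq_norm_sq z
      have h3 := hR v hv
      have h4 := norm_nonneg v
      rw [inner_neg_left, inner_sub_right]
      nlinarith
    refine ⟨z, hzC, ?_⟩
    simp only [hD]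
    rw [sweep_eq_of_halfPlane (c := -z) L s t hL hL' fun v hv => hpos v (by simp [hv]),
      sweep_eq_of_halfPlane (c := -z) M s t hM hM' fun v hv => hpos v (by simp [hv]), sub_self]
  by_contra hne
  have hne' : D y ≠ 0 := sub_ne_zero.2 hne
  have himg := (hC.image D hcont).ordConnected
  have hπ := Real.pi_pos
  obtain ⟨k, hk⟩ := hper y hy
  have hk0 : k ≠ 0 := by
    rintro rfl
    exact hne' (by simpa using hk.symm)
  rw [zsmul_eq_mul] at hk
  obtain ⟨m, hm⟩ : ∃ m : ℤ, (2 * m + 1) * Real.pi ∈ D '' C := by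
    rcases lt_or_gt_of_ne hk0 with h | h
    · refine ⟨-1, himg.out ⟨y, hy, rfl⟩ ⟨z, hzC, rfl⟩ ⟨?_, ?_⟩⟩
      · have : (k : ℝ) ≤ -1 := by exact_mod_cast Int.le_sub_one_of_lt h
        push_cast
        nlinarith
      · rw [hz]; push_cast; nlinarith
    · refine ⟨0, himg.out ⟨z, hzC, rfl⟩ ⟨y, hy, rfl⟩ ⟨?_, ?_⟩⟩
      · rw [hz]; push_cast; nlinarith
      · have : (1 : ℝ) ≤ k := by exact_mod_cast h
        push_cast
        nlinarith
  obtain ⟨x, hx, hxm⟩ := hm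
  obtain ⟨j, hj⟩ := hper x hx
  rw [zsmul_eq_mul, hxm] at hj
  have h1 : ((2 * j : ℤ) : ℝ) = ((2 * m + 1 : ℤ) : ℝ) := by
    apply mul_right_cancel₀ hπ.ne'
    push_cast
    linear_combination hj
  have h2 : 2 * j = 2 * m + 1 := by exact_mod_cast h1
  omega

/-! ### Uniqueness of shortest paths -/

/-- Every point outside `K` can be connected to infinity outside `K`. -/
def Filled (K : Set Pt) : Prop :=
  ∀ y ∉ K, ∃ C : Set Pt, y ∈ C ∧ IsPreconnected C ∧ ¬ Bornology.IsBounded C ∧ Disjoint C K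

lemma SimplePolygon.filled_region (P : SimplePolygon) : Filled P.region := by
  intro y hy
  simp only [SimplePolygon.region, SimplePolygon.interior, Set.mem_union, Set.mem_ofPred_eq,
    not_or, not_and] at hy
  refine ⟨connectedComponentIn P.boundaryᶜ y, mem_connectedComponentIn hy.1,
    isPreconnected_connectedComponentIn, hy.2 hy.1, Set.disjoint_left.2 ?_⟩
  rintro z hz (hzb | ⟨-, hzb⟩)
  · exact connectedComponentIn_subset _ _ hz hzb
  · rw [← connectedComponentIn_eq hz] at hzb
    exact hy.2 hy.1 hzb

lemma turn_pos {u v : Pt} (h : 0 < det2 u v) : 0 < turn u v := by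
  refine lt_of_le_of_ne (Complex.arg_nonneg_iff.2 h.le) fun h0 => ?_
  exact h.ne' (Complex.arg_eq_zero_iff.1 h0.symm).2

lemma turn_neg {u v : Pt} (h : det2 u v < 0) : turn u v < 0 :=
  Complex.arg_neg_iff.2 h

/-- The angles under which the sides of a triangle are seen from an interior point do not
cancel. -/
lemma turn_triangle_ne_zero {p x q y : Pt} {α β : ℝ} (hα : 0 < α) (hβ : 0 < β) (hαβ : α + β < 1)
    (hd : det2 (x - p) (q - p) ≠ 0) (hy : y = x + α • (p - x) + β • (q - x)) :
    turn (p - y) (x - y) + turn (x - y) (q - y) + turn (q - y) (p - y) ≠ 0 := by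
  have e1 : det2 (p - y) (x - y) = β * det2 (x - p) (q - p) := by
    simp [hy, det2]; ring
  have e2 : det2 (x - y) (q - y) = α * det2 (x - p) (q - p) := by
    simp [hy, det2]; ring
  have e3 : det2 (q - y) (p - y) = (1 - α - β) * det2 (x - p) (q - p) := by
    simp [hy, det2]; ring
  have hγ : 0 < 1 - α - β := by linarith
  rcases lt_or_gt_of_ne hd with h | h
  · have h1 := turn_neg (e1 ▸ mul_neg_of_pos_of_neg hβ h)
    have h2 := turn_neg (e2 ▸ mul_neg_of_pos_of_neg hα h)
    have h3 := turn_neg (e3 ▸ mul_neg_of_pos_of_neg hγ h)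
    linarith
  · have h1 := turn_pos (e1 ▸ mul_pos hβ h)
    have h2 := turn_pos (e2 ▸ mul_pos hα h)
    have h3 := turn_pos (e3 ▸ mul_pos hγ h)
    linarith

namespace IsShortest

variable {K : Set Pt} {s t : Pt}

/-- A corner of a shortest path cannot be strictly separated from the remaining vertices of that
path and from another path with the same ends. -/
lemma not_exposed_corner (hK : Filled K) {A : List Pt} {p x q : Pt} {B M : List Pt}
    (hL : IsShortest K s t (A ++ p :: x :: q :: B)) (hM : IsShortest K s t M)
    {c : Pt} {b : ℝ} (hx : b < inner ℝ c x) (hMb : ∀ v ∈ M, inner ℝ c v < b)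
    (hLb : ∀ v ∈ A ++ p :: x :: q :: B, v ≠ x → inner ℝ c v < b) : False := by
  have hnd := hL.nodup
  have hA : ∀ v ∈ A ++ [p], v ≠ x := by
    rintro v hv rfl
    have : A ++ p :: v :: q :: B = (A ++ [p]) ++ v :: q :: B := by simp
    rw [this, List.nodup_append] at hnd
    exact hnd.2.2 v hv v (by simp) rfl
  have hB : ∀ v ∈ q :: B, v ≠ x := by
    rintro v hv rfl
    have : A ++ p :: v :: q :: B = (A ++ [p]) ++ v :: q :: B := by simp
    rw [this, List.nodup_append] at hnd
    exact (List.nodup_cons.1 hnd.2.1).1 hv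
  have hAb : ∀ v ∈ A ++ [p], inner ℝ c v < b := fun v hv => hLb v (by
    simp only [List.mem_append, List.mem_cons, List.not_mem_nil, or_false] at hv ⊢
    tauto) (hA v hv)
  have hBb : ∀ v ∈ q :: B, inner ℝ c v < b := fun v hv => hLb v (by
    simp only [List.mem_append, List.mem_cons] at hv ⊢
    tauto) (hB v hv)
  have hp := hAb p (by simp)
  have hq := hBb q (by simp)
  set S : ℝ := (inner ℝ c x - inner ℝ c p) + (inner ℝ c x - inner ℝ c q) with hS
  have hS0 : 0 < S := by linarith
  set ε : ℝ := (inner ℝ c x - b) / S with hε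
  have hε0 : 0 < ε := div_pos (by linarith) hS0
  have hε1 : ε < 1 := (div_lt_one hS0).2 (by linarith)
  have hεS : ε * S = inner ℝ c x - b := div_mul_cancel₀ _ hS0.ne'
  obtain ⟨y, hy, hyK⟩ := hL.exists_notMem_of_corner hε0 hε1.le
  have hsub := hL.subset
  have hseg1 : segment ℝ p x ⊆ K := (segment_subset_polylineSet A p x (q :: B)).trans hsub
  have hseg2 : segment ℝ x q ⊆ K := by
    refine (segment_subset_polylineSet (A ++ [p]) x q B).trans ?_
    simpa using hsub
  rw [segment_eq_image'] at hy
  obtain ⟨r, ⟨hr0, hr1⟩, rfl⟩ := hy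
  set y := x + ε • (p - x) + r • (x + ε • (q - x) - (x + ε • (p - x))) with hyd
  have hr0' : r ≠ 0 := by
    rintro rfl
    refine hyK (hseg1 ?_)
    rw [segment_symm, segment_eq_image']
    exact ⟨ε, ⟨hε0.le, hε1.le⟩, by simp⟩
  have hr1' : r ≠ 1 := by
    rintro rfl
    refine hyK (hseg2 ?_)
    rw [segment_eq_image']
    exact ⟨ε, ⟨hε0.le, hε1.le⟩, by simp⟩
  have hr0 := lt_of_le_of_ne hr0 hr0'.symm
  have hr1 := lt_of_le_of_ne hr1 hr1'
  have hyb : b < inner ℝ c y := by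
    have e : inner ℝ c y = inner ℝ c x - ε * ((1 - r) * (inner ℝ c x - inner ℝ c p)
        + r * (inner ℝ c x - inner ℝ c q)) := by
      simp only [hyd, inner_add_right, inner_sub_right, inner_smul_right]
      ring
    have h1 : (1 - r) * (inner ℝ c x - inner ℝ c p) + r * (inner ℝ c x - inner ℝ c q) < S := by
      nlinarith
    nlinarith
  have hside : ∀ v, inner ℝ c v < b → 0 < inner ℝ (-c) (v - y) := by
    intro v hv
    rw [inner_neg_left, inner_sub_right]
    linarith
  obtain ⟨C, hyC, hC, hCb, hCK⟩ := hK y hyK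
  have key := sweep_eq_of_unbounded hL.head hL.last hM.head hM.last hC hCb
    (hCK.mono_right hL.subset) (hCK.mono_right hM.subset) hyC
  have sA := sweep_eq_of_halfPlane (y := y) (c := -c) (A ++ [p]) s p
    (by have := hL.head; cases A <;> simpa using this) (by simp)
    fun v hv => hside v (hAb v hv)
  have sB := sweep_eq_of_halfPlane (y := y) (c := -c) (q :: B) q t (by simp)
    (by have := hL.last; simp at this ⊢; exact this) fun v hv => hside v (hBb v hv)
  have sM := sweep_eq_of_halfPlane (y := y) (c := -c) M s t hM.head hM.last
    fun v hv => hside v (hMb v hv)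
  have tqp := turn_eq_sub (hside q hq) (hside p hp)
  have hne := turn_triangle_ne_zero (p := p) (x := x) (q := q) (y := y) (α := ε * (1 - r))
    (β := ε * r) (mul_pos hε0 (by linarith)) (mul_pos hε0 hr0) (by linarith)
    (hL.bend A p x q B rfl) (by rw [hyd]; module)
  apply hne
  rw [sM, sweep, edgeSum_append] at key
  simp only [edgeSum] at key
  simp only [sweep] at sA sB
  rw [sA, sB] at key
  linarith

lemma eq_of_subset_segment {L : List Pt} (h : IsShortest K s t L)
    (hseg : ∀ v ∈ L, v ∈ segment ℝ s t) : L = [s] ∧ s = t ∨ L = [s, t] ∧ s ≠ t := by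
  match L, h, hseg with
  | [], h, _ => simpa using h.head
  | [a], h, _ =>
    have h1 := h.head
    have h2 := h.last
    simp at h1 h2
    subst h1
    exact Or.inl ⟨rfl, h2⟩
  | [a, b], h, _ =>
    have h1 := h.head
    have h2 := h.last
    have h3 := h.ne [] a b [] rfl
    simp at h1 h2
    subst h1 h2
    exact Or.inr ⟨rfl, h3⟩
  | a :: b :: c :: l, h, hseg =>
    exfalso
    refine h.bend [] a b c l rfl ?_
    have h1 := hseg a (by simp)
    have h2 := hseg b (by simp)
    have h3 := hseg c (by simp)
    rw [segment_eq_image'] at h1 h2 h3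
    obtain ⟨r1, -, rfl⟩ := h1
    obtain ⟨r2, -, rfl⟩ := h2
    obtain ⟨r3, -, rfl⟩ := h3
    simp [det2]
    ring

lemma not_exposed_only_left (hK : Filled K) {L M : List Pt} (hL : IsShortest K s t L)
    (hM : IsShortest K s t M) {x : Pt} (hxL : x ∈ L) (hxM : x ∉ M) (hxs : x ≠ s) (hxt : x ≠ t)
    {c : Pt} {b : ℝ} (hx : b < inner ℝ c x)
    (hb : ∀ v, v ∈ L ∨ v ∈ M → v ≠ x → inner ℝ c v < b) : False := by
  obtain ⟨A, B, rfl⟩ := List.append_of_mem hxL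
  have h1 := hL.head
  have h2 := hL.last
  rcases List.eq_nil_or_concat' A with rfl | ⟨A, p, rfl⟩
  · simp at h1; exact hxs h1
  cases B with
  | nil => simp at h2; exact hxt h2
  | cons q B =>
    have e : A ++ [p] ++ x :: q :: B = A ++ p :: x :: q :: B := by simp
    rw [e] at hL hb
    exact hL.not_exposed_corner hK hM hx
      (fun v hv => hb v (Or.inr hv) (by rintro rfl; exact hxM hv)) fun v hv => hb v (Or.inl hv)

/-- Shortest paths in a filled set are unique. -/
theorem eq (hK : Filled K) {L M : List Pt} (hL : IsShortest K s t L)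
    (hM : IsShortest K s t M) : L = M := by
  induction hn : L.length + M.length using Nat.strong_induction_on generalizing s t L M with
  | _ n ih =>
  set V : Set Pt := {v | v ∈ L ∨ v ∈ M} with hV
  have hVfin : V.Finite := (L.finite_toSet).union (M.finite_toSet)
  by_cases hext : ∃ x ∈ (convexHull ℝ V).extremePoints ℝ, x ≠ s ∧ x ≠ t
  · obtain ⟨x, hx, hxs, hxt⟩ := hext
    have hxV : x ∈ V := extremePoints_convexHull_subset hx
    have hx' : x ∉ convexHull ℝ (V \ {x}) := fun h =>
      ((convex_convexHull ℝ V).mem_extremePoints_iff_mem_sdiff_convexHull_sdiff.1 hx).2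
        (convexHull_mono (Set.sdiff_subset_sdiff_left (subset_convexHull ℝ V)) h)
    obtain ⟨f, b, hfb, hfx⟩ := geometric_hahn_banach_closed_point (convex_convexHull ℝ (V \ {x}))
      ((hVfin.sdiff).isCompact_convexHull ℝ).isClosed hx'
    set c := (InnerProductSpace.toDual ℝ Pt).symm f
    have hc : ∀ z, f z = inner ℝ c z := fun z => InnerProductSpace.toDual_symm_apply.symm
    simp only [hc] at hfb hfx
    have hb : ∀ v, v ∈ L ∨ v ∈ M → v ≠ x → inner ℝ c v < b := fun v hv hvx =>
      hfb v (subset_convexHull ℝ _ ⟨hv, hvx⟩)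
    by_cases hxL : x ∈ L
    · by_cases hxM : x ∈ M
      · obtain ⟨A, B, rfl⟩ := List.append_of_mem hxL
        obtain ⟨C, D, rfl⟩ := List.append_of_mem hxM
        have hA : A ≠ [] := by
          rintro rfl
          exact hxs (by simpa using hL.head)
        have hB : B ≠ [] := by
          rintro rfl
          exact hxt (by simpa using hL.last)
        have hA := List.length_pos_of_ne_nil hA
        have hB := List.length_pos_of_ne_nil hB
        simp only [List.length_append, List.length_cons] at hn
        have h1 := ih _ (by simp; omega) hL.prefix_shortest hM.prefix_shortest rfl
        have h2 := ih _ (by simp; omega) hL.suffix_shortest hM.suffix_shortest rfl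
        rw [List.append_cancel_right h1, h2]
      · exact (hL.not_exposed_only_left hK hM hxL hxM hxs hxt hfx hb).elim
    · have hxM : x ∈ M := hxV.resolve_left hxL
      exact (hM.not_exposed_only_left hK hL hxM hxL hxs hxt hfx
        fun v hv => hb v hv.symm).elim
  · push Not at hext
    have hsub : convexHull ℝ V ⊆ segment ℝ s t := by
      rw [← closure_convexHull_extremePoints (hVfin.isCompact_convexHull ℝ)
        (convex_convexHull ℝ V), ← convexHull_pair]
      refine closure_minimal (convexHull_mono fun x hx => ?_)
        ((Set.toFinite {s, t}).isCompact_convexHull ℝ).isClosed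
      by_cases h : x = s
      · exact Or.inl h
      · exact Or.inr (hext x hx h)
    have h1 := hL.eq_of_subset_segment fun v hv => hsub (subset_convexHull ℝ V (Or.inl hv))
    have h2 := hM.eq_of_subset_segment fun v hv => hsub (subset_convexHull ℝ V (Or.inr hv))
    rcases h1 with ⟨h1, h⟩ | ⟨h1, h⟩ <;> rcases h2 with ⟨h2, h'⟩ | ⟨h2, h'⟩
    · rw [h1, h2]
    · exact absurd h h'
    · exact absurd h' h
    · rw [h1, h2]

end IsShortest

/-! ### The polygon near a corner of two shortest paths -/

/-- A segment through `p` lies on the rays from `p` towards its ends. -/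
lemma exists_ray_of_mem_segment {a b p z : Pt} (hp : p ∈ segment ℝ a b) (hz : z ∈ segment ℝ a b) :
    ∃ r : ℝ, 0 ≤ r ∧ (z = p + r • (a - p) ∨ z = p + r • (b - p)) := by
  rw [segment_eq_image'] at hp hz
  obtain ⟨u, ⟨hu0, hu1⟩, rfl⟩ := hp
  obtain ⟨v, ⟨hv0, hv1⟩, rfl⟩ := hz
  rcases le_total v u with h | h
  · rcases hu0.eq_or_lt with rfl | hu0
    · obtain rfl : v = 0 := le_antisymm h hv0
      exact ⟨0, le_rfl, by simp⟩
    · refine ⟨(u - v) / u, div_nonneg (by linarith) hu0.le, Or.inl ?_⟩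
      have : (u - v) / u * u = u - v := div_mul_cancel₀ _ hu0.ne'
      have e : a - (a + u • (b - a)) = -(u • (b - a)) := by module
      simp only [e, smul_neg, smul_smul, this]
      module
  · rcases hu1.eq_or_lt with rfl | hu1
    · obtain rfl : v = 1 := le_antisymm hv1 h
      exact ⟨0, le_rfl, by simp⟩
    · have hu1 : 0 < 1 - u := by linarith
      refine ⟨(v - u) / (1 - u), div_nonneg (by linarith) hu1.le, Or.inr ?_⟩
      have : (v - u) / (1 - u) * (1 - u) = v - u := div_mul_cancel₀ _ hu1.ne'
      have e : b - (a + u • (b - a)) = (1 - u) • (b - a) := by module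
      simp only [e, smul_smul, this]
      module

/-- Three vectors in a suitable radial order do not lie on two rays. -/
lemma not_on_two_rays {a b c f e₁ e₂ : Pt} (hab : 0 < det2 a b) (ha : 0 ≤ det2 f a)
    (hb : 0 < det2 f b) (hc : det2 f c < 0)
    (hra : ∃ r : ℝ, 0 ≤ r ∧ (a = r • e₁ ∨ a = r • e₂))
    (hrb : ∃ r : ℝ, 0 ≤ r ∧ (b = r • e₁ ∨ b = r • e₂))
    (hrc : ∃ r : ℝ, 0 ≤ r ∧ (c = r • e₁ ∨ c = r • e₂)) : False := by
  have h_ab : ∀ (e : Pt) (r r' : ℝ), a = r • e → b = r' • e → False := by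
    rintro e r r' rfl rfl
    simp only [det2, PiLp.smul_apply, smul_eq_mul] at hab
    ring_nf at hab
    exact lt_irrefl _ hab
  have h_bc : ∀ (e : Pt) (r r' : ℝ), 0 ≤ r → 0 ≤ r' → b = r • e → c = r' • e → False := by
    rintro e r r' hr hr' rfl rfl
    have h1 : det2 f (r • e) = r * det2 f e := by simp [det2]; ring
    have h2 : det2 f (r' • e) = r' * det2 f e := by simp [det2]; ring
    rw [h1] at hb
    rw [h2] at hc
    exact absurd (mul_nonneg hr' (pos_of_mul_pos_right hb hr).le) hc.not_ge
  have h_ac : ∀ (e : Pt) (r r' : ℝ), 0 ≤ r → 0 ≤ r' → a = r • e → c = r' • e → False := by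
    rintro e r r' hr hr' rfl rfl
    have h1 : det2 f (r • e) = r * det2 f e := by simp [det2]; ring
    have h2 : det2 f (r' • e) = r' * det2 f e := by simp [det2]; ring
    rw [h1] at ha
    rw [h2] at hc
    rcases hr.eq_or_lt with rfl | hr
    · simp [det2] at hab
    · exact absurd (mul_nonneg hr' (nonneg_of_mul_nonneg_right ha hr)) hc.not_ge
  obtain ⟨r, hr, ha'⟩ := hra
  obtain ⟨r', hr', hb'⟩ := hrb
  obtain ⟨r'', hr'', hc'⟩ := hrc
  rcases ha' with ha' | ha' <;> rcases hb' with hb' | hb' <;> rcases hc' with hc' | hc'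
  · exact h_ab _ _ _ ha' hb'
  · exact h_ab _ _ _ ha' hb'
  · exact h_ac _ _ _ hr hr'' ha' hc'
  · exact h_bc _ _ _ hr' hr'' hb' hc'
  · exact h_bc _ _ _ hr' hr'' hb' hc'
  · exact h_ac _ _ _ hr hr'' ha' hc'
  · exact h_ab _ _ _ ha' hb'
  · exact h_ab _ _ _ ha' hb'

namespace SimplePolygon

lemma mem_boundary_iff (P : SimplePolygon) {z : Pt} :
    z ∈ P.boundary ↔ ∃ i < P.n, z ∈ segment ℝ (P.vtx i) (P.vtx (i + 1)) := by
  simp [boundary]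

/-- At most two boundary rays leave every point of the plane. -/
lemma exists_two_rays (P : SimplePolygon) (p : Pt) :
    ∃ e₁ e₂ : Pt, ∀ i < P.n, p ∈ segment ℝ (P.vtx i) (P.vtx (i + 1)) →
      ∀ z ∈ segment ℝ (P.vtx i) (P.vtx (i + 1)),
        ∃ r : ℝ, 0 ≤ r ∧ (z = p + r • e₁ ∨ z = p + r • e₂) := by
  set S := {i | i < P.n ∧ p ∈ segment ℝ (P.vtx i) (P.vtx (i + 1))} with hS
  have hfin : S.Finite := (Set.finite_lt_nat P.n).subset fun i hi => hi.1
  have hn := P.three_le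
  by_cases hv : ∃ k < P.n, p = P.vtx k
  · obtain ⟨k, hk, rfl⟩ := hv
    obtain ⟨j, hj, hjk, hvj⟩ : ∃ j < P.n, j ≠ k ∧ P.vtx (j + 1) = P.vtx k := by
      rcases Nat.eq_zero_or_pos k with rfl | hk0
      · refine ⟨P.n - 1, by omega, by omega, ?_⟩
        rw [← P.periodic 0]
        congr 1
        omega
      · exact ⟨k - 1, by omega, by omega, by congr 1; omega⟩
    have hkS : k ∈ S := ⟨hk, left_mem_segment ℝ _ _⟩
    have hjS : j ∈ S := ⟨hj, hvj ▸ right_mem_segment ℝ _ _⟩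
    have hSeq : {j, k} = S := Set.eq_of_subset_of_ncard_le
      (Set.insert_subset hjS (Set.singleton_subset_iff.2 hkS))
      (by rw [Set.ncard_pair hjk]; exact P.simple _) hfin
    refine ⟨P.vtx j - P.vtx k, P.vtx (k + 1) - P.vtx k, fun i hi hpi z hz => ?_⟩
    have hiS : i ∈ S := ⟨hi, hpi⟩
    rw [← hSeq] at hiS
    rcases hiS with rfl | rfl
    · rw [hvj, segment_symm, segment_eq_image'] at hz
      obtain ⟨r, hr, rfl⟩ := hz
      exact ⟨r, hr.1, Or.inl rfl⟩
    · rw [segment_eq_image'] at hz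
      obtain ⟨r, hr, rfl⟩ := hz
      exact ⟨r, hr.1, Or.inr rfl⟩
  · have hcard : S.ncard ≤ 1 := by
      have h1 : S.ncard ≤ 2 := P.simple p
      have h2 : S.ncard ≠ 2 := fun h => hv (P.vtx_of_two p h)
      omega
    rcases S.eq_empty_or_nonempty with h0 | ⟨j, hj⟩
    · refine ⟨0, 0, fun i hi hpi => ?_⟩
      have : i ∈ S := ⟨hi, hpi⟩
      simp [h0] at this
    · refine ⟨P.vtx j - p, P.vtx (j + 1) - p, fun i hi hpi z hz => ?_⟩
      obtain rfl : i = j := (Set.ncard_le_one hfin).1 hcard i ⟨hi, hpi⟩ j hj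
      exact exists_ray_of_mem_segment hpi hz

/-- Near a point, the boundary lies on at most two rays. -/
lemma exists_ball_boundary_subset_rays (P : SimplePolygon) (p : Pt) :
    ∃ δ > 0, ∃ e₁ e₂ : Pt, ∀ z ∈ P.boundary, z ∈ Metric.ball p δ →
      ∃ r : ℝ, 0 ≤ r ∧ (z = p + r • e₁ ∨ z = p + r • e₂) := by
  obtain ⟨e₁, e₂, he⟩ := P.exists_two_rays p
  set F : Set Pt := ⋃ i ∈ {i | i < P.n ∧ p ∉ segment ℝ (P.vtx i) (P.vtx (i + 1))},
    segment ℝ (P.vtx i) (P.vtx (i + 1)) with hF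
  have hFc : IsClosed F := by
    refine Set.Finite.isClosed_biUnion ((Set.finite_lt_nat P.n).subset fun i hi => hi.1)
      fun i _ => ?_
    rw [← convexHull_pair]
    exact ((Set.toFinite _).isCompact_convexHull ℝ).isClosed
  have hpF : p ∉ F := by
    simp only [hF, Set.mem_iUnion, not_exists]
    exact fun i hi => hi.2
  obtain ⟨δ, hδ, hball⟩ := Metric.isOpen_iff.1 hFc.isOpen_compl p hpF
  refine ⟨δ, hδ, e₁, e₂, fun z hz hzb => ?_⟩
  obtain ⟨i, hi, hzi⟩ := P.mem_boundary_iff.1 hz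
  refine he i hi ?_ z hzi
  by_contra hpi
  exact hball hzb (Set.mem_biUnion (show i ∈ {i | _} from ⟨hi, hpi⟩) hzi)

/-- A segment leaving the polygon crosses the boundary. -/
lemma exists_mem_boundary_of_segment (P : SimplePolygon) {y z : Pt} (hy : y ∉ P.region)
    (hz : z ∈ P.region) : ∃ x ∈ segment ℝ y z, x ∈ P.boundary := by
  by_contra! h
  have hsub : segment ℝ y z ⊆ connectedComponentIn P.boundaryᶜ y :=
    (convex_segment y z).isPreconnected.subset_connectedComponentIn (left_mem_segment ℝ y z) h
  have hyb : y ∉ P.boundary := fun h => hy (Or.inl h)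
  rcases hz with hz | ⟨-, hz⟩
  · exact h z (right_mem_segment ℝ y z) hz
  · rw [← connectedComponentIn_eq (hsub (right_mem_segment ℝ y z))] at hz
    exact hy (Or.inr ⟨hyb, hz⟩)

/-- Two shortest paths with a common edge cannot turn to different sides at its end. -/
lemma not_turn_both_sides (P : SimplePolygon) {q p x y s t t' : Pt} {A B B' : List Pt}
    (hx : IsShortest P.region s t (A ++ q :: p :: x :: B))
    (hy : IsShortest P.region s t' (A ++ q :: p :: y :: B'))
    (hdx : 0 < det2 (q - p) (x - p)) (hdy : det2 (q - p) (y - p) < 0) : False := by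
  obtain ⟨δ, hδ, e₁, e₂, hrays⟩ := P.exists_ball_boundary_subset_rays p
  set f₀ := q - p
  set f₁ := x - p
  set f₂ := y - p
  have hmem : ∀ f : Pt, ∃ η > 0, ∀ ε : ℝ, 0 < ε → ε ≤ η → p + ε • f ∈ Metric.ball p δ := by
    intro f
    refine ⟨δ / (‖f‖ + 1), by positivity, fun ε h0 h1 => ?_⟩
    rw [le_div_iff₀ (by positivity)] at h1
    rw [mem_ball_iff_norm, add_sub_cancel_left, norm_smul, Real.norm_of_nonneg h0.le]
    nlinarith
  obtain ⟨η₀, hη₀, hb₀⟩ := hmem f₀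
  obtain ⟨η₁, hη₁, hb₁⟩ := hmem f₁
  obtain ⟨η₂, hη₂, hb₂⟩ := hmem f₂
  obtain ⟨ε, hε, hε1, hε0, hε1', hε2⟩ : ∃ ε > 0, ε ≤ 1 ∧ ε ≤ η₀ ∧ ε ≤ η₁ ∧ ε ≤ η₂ :=
    ⟨min (min 1 η₀) (min η₁ η₂), by positivity, by simp, by simp, by simp, by simp⟩
  have hb₀ := hb₀ ε hε hε0
  have hb₁ := hb₁ ε hε hε1'
  have hb₂ := hb₂ ε hε hε2
  have hreg : ∀ {z u : Pt} {D : List Pt}, IsShortest P.region s u (A ++ q :: p :: z :: D) →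
      p + ε • (q - p) ∈ P.region ∧ p + ε • (z - p) ∈ P.region := by
    intro z u D h
    constructor
    · refine h.subset (segment_subset_polylineSet A q p _ ?_)
      rw [segment_symm, segment_eq_image']
      exact ⟨ε, ⟨hε.le, hε1⟩, rfl⟩
    · have h2 := h.subset
      have e : A ++ q :: p :: z :: D = (A ++ [q]) ++ p :: z :: D := by simp
      rw [e] at h2
      refine h2 (segment_subset_polylineSet _ p z _ ?_)
      rw [segment_eq_image']
      exact ⟨ε, ⟨hε.le, hε1⟩, rfl⟩
  obtain ⟨hA₀, hA₁⟩ := hreg hx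
  obtain ⟨-, hA₂⟩ := hreg hy
  obtain ⟨y₁, hy₁, hy₁K⟩ := hx.exists_notMem_of_corner hε hε1
  obtain ⟨y₂, hy₂, hy₂K⟩ := hy.exists_notMem_of_corner hε hε1
  obtain ⟨z₀, hz₀, hz₀b⟩ := P.exists_mem_boundary_of_segment hy₁K hA₀
  obtain ⟨z₁, hz₁, hz₁b⟩ := P.exists_mem_boundary_of_segment hy₁K hA₁
  obtain ⟨z₂, hz₂, hz₂b⟩ := P.exists_mem_boundary_of_segment hy₂K hA₂
  have hbd : ∀ {z w : Pt}, z ∈ P.boundary → w ∉ P.region → z ≠ w := by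
    rintro z w hz hw rfl
    exact hw (Or.inl hz)
  have hball : ∀ {a b c d : Pt}, a ∈ Metric.ball p δ → b ∈ Metric.ball p δ →
      c ∈ segment ℝ a b → ∀ v ∈ segment ℝ c d, d ∈ Metric.ball p δ → v ∈ Metric.ball p δ :=
    fun ha hb hc v hv hd => (convex_ball p δ).segment_subset
      ((convex_ball p δ).segment_subset ha hb hc) hd hv
  have hr₀ := hrays z₀ hz₀b (hball hb₀ hb₁ hy₁ z₀ hz₀ hb₀)
  have hr₁ := hrays z₁ hz₁b (hball hb₀ hb₁ hy₁ z₁ hz₁ hb₁)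
  have hr₂ := hrays z₂ hz₂b (hball hb₀ hb₂ hy₂ z₂ hz₂ hb₂)
  have hne₀ := hbd hz₀b hy₁K
  have hy₁A₀ : y₁ ≠ p + ε • f₀ := fun h => hy₁K (h ▸ hA₀)
  have hy₂A₀ : y₂ ≠ p + ε • f₀ := fun h => hy₂K (h ▸ hA₀)
  rw [segment_eq_image'] at hy₁ hy₂ hz₀ hz₁ hz₂
  obtain ⟨s₁, ⟨hs₁, hs₁'⟩, rfl⟩ := hy₁
  obtain ⟨s₂, ⟨hs₂, hs₂'⟩, rfl⟩ := hy₂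
  obtain ⟨r₀, ⟨hr₀p, hr₀1⟩, rfl⟩ := hz₀
  obtain ⟨r₁, ⟨hr₁p, hr₁1⟩, rfl⟩ := hz₁
  obtain ⟨r₂, ⟨hr₂p, hr₂1⟩, rfl⟩ := hz₂
  have hs₁0 : 0 < s₁ := hs₁.lt_of_ne' fun h => hy₁A₀ (by simp [h, f₀])
  have hs₂0 : 0 < s₂ := hs₂.lt_of_ne' fun h => hy₂A₀ (by simp [h, f₀])
  have hr₀0 : 0 < r₀ := hr₀p.lt_of_ne' fun h => hne₀ (by simp [h])
  have hray : ∀ {z : Pt}, (∃ r : ℝ, 0 ≤ r ∧ (z = p + r • e₁ ∨ z = p + r • e₂)) →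
      ∃ r : ℝ, 0 ≤ r ∧ (z - p = r • e₁ ∨ z - p = r • e₂) := by
    rintro z ⟨r, hr, h⟩
    exact ⟨r, hr, h.imp sub_eq_of_eq_add' sub_eq_of_eq_add'⟩
  refine not_on_two_rays (f := f₀) ?_ ?_ ?_ ?_ (hray hr₀) (hray hr₁) (hray hr₂)
  · have : 0 < ε ^ 2 * (r₁ * (1 - s₁) + s₁ * r₀) * det2 f₀ f₁ := by
      have := mul_nonneg hr₁p (sub_nonneg.2 hs₁')
      positivity
    convert this using 1
    simp only [f₀, f₁, det2, PiLp.add_apply, PiLp.sub_apply, PiLp.smul_apply, smul_eq_mul]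
    ring
  · have : 0 ≤ ε * (s₁ * (1 - r₀)) * det2 f₀ f₁ := by
      have := sub_nonneg.2 hr₀1
      positivity
    convert this using 1
    simp only [f₀, f₁, det2, PiLp.add_apply, PiLp.sub_apply, PiLp.smul_apply, smul_eq_mul]
    ring
  · have : 0 < ε * (s₁ + r₁ * (1 - s₁)) * det2 f₀ f₁ := by
      have := mul_nonneg hr₁p (sub_nonneg.2 hs₁')
      positivity
    convert this using 1
    simp only [f₀, f₁, det2, PiLp.add_apply, PiLp.sub_apply, PiLp.smul_apply, smul_eq_mul]
    ring
  · have : ε * (s₂ + r₂ * (1 - s₂)) * det2 f₀ f₂ < 0 := by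
      have := mul_nonneg hr₂p (sub_nonneg.2 hs₂')
      exact mul_neg_of_pos_of_neg (by positivity) hdy
    convert this using 1
    simp only [f₀, f₂, det2, PiLp.add_apply, PiLp.sub_apply, PiLp.smul_apply, smul_eq_mul]
    ring

end SimplePolygon

/-! ### Radial order of shortest paths -/

lemma det2_mul_det2 (d x y z : Pt) :
    det2 d y * det2 x z = det2 d x * det2 y z + det2 d z * det2 x y := by
  simp only [det2]
  ring

lemma List.eq_take_append_of_getElem? {α : Type*} {L : List α} {k : ℕ} {q p x : α}
    (hq : L[k]? = some q) (hp : L[k + 1]? = some p) (hx : L[k + 2]? = some x) :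
    L = L.take k ++ q :: p :: x :: L.drop (k + 3) := by
  obtain ⟨h0, rfl⟩ := List.getElem?_eq_some_iff.1 hq
  obtain ⟨h1, rfl⟩ := List.getElem?_eq_some_iff.1 hp
  obtain ⟨h2, rfl⟩ := List.getElem?_eq_some_iff.1 hx
  conv_lhs => rw [← List.take_append_drop k L, List.drop_eq_getElem_cons h0,
    List.drop_eq_getElem_cons h1, List.drop_eq_getElem_cons h2]

/-- The polygonal paths `L` and `M` agree before index `i`, and there `M` leaves to the left
of `L`. -/
def LeavesLeft (L M : List Pt) (i : ℕ) : Prop :=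
  0 < i ∧ (∀ j < i, L[j]? = M[j]?) ∧
    ∃ a b c : Pt, L[i - 1]? = some a ∧ L[i]? = some b ∧ M[i]? = some c ∧ 0 < det2 (b - a) (c - a)

lemma LeavesLeft.getElem?_ne {L M : List Pt} {i : ℕ} (h : LeavesLeft L M i) : L[i]? ≠ M[i]? := by
  obtain ⟨-, -, a, b, c, -, hb, hc, hd⟩ := h
  intro e
  obtain rfl : b = c := by simpa [hb, hc] using e
  simp only [det2] at hd
  linarith

/-- The first edge of a path leaving to the left. -/
lemma LeavesLeft.first {L M : List Pt} {i : ℕ} {a b c : Pt} (h : LeavesLeft L M i)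
    (ha : L[0]? = some a) (hb : L[1]? = some b) (hc : M[1]? = some c) :
    c = b ∨ 0 < det2 (b - a) (c - a) := by
  obtain ⟨hi, hag, a', b', c', ha', hb', hc', hd⟩ := h
  rcases (Nat.succ_le_of_lt hi).eq_or_lt with rfl | hi
  · simp_all
  · left
    have := hag 1 hi
    simpa [hb, hc, eq_comm] using this

lemma det2_self (x : Pt) : det2 x x = 0 := by
  simp only [det2]
  ring

lemma det2_pos_of_radial {β U V W : Pt} (hu : U = β ∨ 0 < det2 β U)
    (hv : V = β ∨ 0 < det2 β V) (hw : W = β ∨ 0 < det2 β W)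
    (huv : 0 < det2 U V) (hvw : 0 < det2 V W) : 0 < det2 U W := by
  have hanti : ∀ x y : Pt, det2 x y = -det2 y x := fun x y => by simp only [det2]; ring
  have hv : 0 < det2 β V := by
    refine hv.resolve_left ?_
    rintro rfl
    rcases hu with rfl | hu
    · simp [det2_self] at huv
    · linarith [hanti U V]
  have hw : 0 < det2 β W := by
    refine hw.resolve_left ?_
    rintro rfl
    linarith [hanti W V]
  rcases hu with rfl | hu
  · exact hw
  · refine pos_of_mul_pos_right ?_ hv.le
    rw [det2_mul_det2]
    positivity

/-- At a common corner, the paths through an edge are in transitive radial order. -/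
lemma SimplePolygon.det2_pos_of_corner (P : SimplePolygon) {a u v w p x y z : Pt}
    {L M N : List Pt} {k : ℕ} (hL : IsShortest P.region a u L) (hM : IsShortest P.region a v M)
    (hN : IsShortest P.region a w N) (hLM : ∀ j < k + 2, L[j]? = M[j]?)
    (hMN : ∀ j < k + 2, M[j]? = N[j]?) (hp : L[k + 1]? = some p) (hx : L[k + 2]? = some x)
    (hy : M[k + 2]? = some y) (hz : N[k + 2]? = some z) (hxy : 0 < det2 (x - p) (y - p))
    (hyz : 0 < det2 (y - p) (z - p)) : 0 < det2 (x - p) (z - p) := by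
  obtain ⟨q, hq⟩ : ∃ q, L[k]? = some q := by
    have := (List.getElem?_eq_some_iff.1 hp).1
    exact ⟨L[k], List.getElem?_eq_getElem _⟩
  have hq' : M[k]? = some q := hLM k (by omega) ▸ hq
  have hp' : M[k + 1]? = some p := hLM (k + 1) (by omega) ▸ hp
  have hq'' : N[k]? = some q := hMN k (by omega) ▸ hq'
  have hp'' : N[k + 1]? = some p := hMN (k + 1) (by omega) ▸ hp'
  have htake : ∀ {A B : List Pt}, (∀ j < k + 2, A[j]? = B[j]?) → B.take k = A.take k := by
    intro A B h
    ext1 j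
    rw [List.getElem?_take, List.getElem?_take]
    split_ifs with hj
    · exact (h j (by omega)).symm
    · rfl
  rw [List.eq_take_append_of_getElem? hq hp hx] at hL
  rw [List.eq_take_append_of_getElem? hq' hp' hy, htake hLM] at hM
  rw [List.eq_take_append_of_getElem? hq'' hp'' hz, htake hMN, htake hLM] at hN
  have hb : ∀ {r : Pt}, det2 (p - q) (r - q) = -det2 (q - p) (r - p) := by
    intro r
    simp only [det2, PiLp.sub_apply]
    ring
  have hx0 : det2 (q - p) (x - p) ≠ 0 := fun h => hL.bend _ _ _ _ _ rfl (by rw [hb, h, neg_zero])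
  have hy0 : det2 (q - p) (y - p) ≠ 0 := fun h => hM.bend _ _ _ _ _ rfl (by rw [hb, h, neg_zero])
  have hz0 : det2 (q - p) (z - p) ≠ 0 := fun h => hN.bend _ _ _ _ _ rfl (by rw [hb, h, neg_zero])
  have key := det2_mul_det2 (q - p) (x - p) (y - p) (z - p)
  rcases hy0.lt_or_gt with hy0 | hy0
  · have hx0 := hx0.lt_or_gt.resolve_right fun h => P.not_turn_both_sides hL hM h hy0
    have hz0 := hz0.lt_or_gt.resolve_right fun h => P.not_turn_both_sides hN hM h hy0
    nlinarith [mul_pos (neg_pos.2 hx0) hyz, mul_pos (neg_pos.2 hz0) hxy]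
  · have hx0 := hx0.lt_or_gt.resolve_left fun h => P.not_turn_both_sides hM hL hy0 h
    have hz0 := hz0.lt_or_gt.resolve_left fun h => P.not_turn_both_sides hM hN hy0 h
    refine pos_of_mul_pos_right ?_ hy0.le
    rw [key]
    positivity

/-- A geodesic triple in counterclockwise order, in terms of given geodesics. -/
lemma geodesicCCW.exists_leavesLeft {P : SimplePolygon} {p q r : Pt} {L M : List Pt}
    (h : geodesicCCW P p q r) (hL : IsShortest P.region p q L) (hM : IsShortest P.region p r M) :
    ∃ i, LeavesLeft L M i := by
  obtain ⟨L', M', hL', hM', i, hi, hag, -, hd⟩ := h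
  obtain rfl := IsShortest.eq P.filled_region hL'.isShortest hL
  obtain rfl := IsShortest.eq P.filled_region hM'.isShortest hM
  exact ⟨i, hi, hag, hd⟩

/-- Paths to the left of a common path are in transitive radial order. -/
lemma SimplePolygon.leavesLeft_trans (P : SimplePolygon) {a b u v w : Pt} {K L M N : List Pt}
    {k₁ k₂ k₃ i j : ℕ} (hK : IsShortest P.region a b K) (hL : IsShortest P.region a u L)
    (hM : IsShortest P.region a v M) (hN : IsShortest P.region a w N) (hKL : LeavesLeft K L k₁)
    (hKM : LeavesLeft K M k₂) (hKN : LeavesLeft K N k₃) (hLM : LeavesLeft L M i)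
    (hMN : LeavesLeft M N j) : ∃ l, LeavesLeft L N l := by
  obtain ⟨hi, hag, p, x, y, hp, hx, hy, hd⟩ := hLM
  obtain ⟨hj, hag', p', y', z, hp', hy', hz, hd'⟩ := hMN
  rcases lt_trichotomy i j with h | rfl | h
  · exact ⟨i, hi, fun l hl => (hag l hl).trans (hag' l (hl.trans h)), p, x, y, hp, hx,
      (hag' i h).symm.trans hy, hd⟩
  · have hpp : L[i - 1]? = M[i - 1]? := hag _ (by omega)
    obtain rfl : p = p' := by simpa [hp, hp'] using hpp
    obtain rfl : y = y' := by simpa [hy] using hy'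
    refine ⟨i, hi, fun l hl => (hag l hl).trans (hag' l hl), p, x, z, hp, hx, hz, ?_⟩
    obtain _ | _ | k := i
    · omega
    · have h0 : ∀ {t : Pt} {A : List Pt}, IsShortest P.region a t A → A[0]? = some a := by
        intro t A h
        rw [← List.head?_eq_getElem?]
        exact h.head
      obtain rfl : a = p := by
        have := h0 hL
        simpa [this] using hp
      obtain ⟨c, hc⟩ : ∃ c, K[1]? = some c := by
        obtain ⟨hk, -, -, c, -, -, hc, -⟩ := hKL
        have := (List.getElem?_eq_some_iff.1 hc).1
        exact ⟨K[1], List.getElem?_eq_getElem _⟩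
      have hsub : ∀ {r : Pt}, r = c ∨ 0 < det2 (c - a) (r - a) →
          r - a = c - a ∨ 0 < det2 (c - a) (r - a) := fun h => h.imp_left (by rintro rfl; rfl)
      exact det2_pos_of_radial (hsub (hKL.first (h0 hK) hc hx)) (hsub (hKM.first (h0 hK) hc hy))
        (hsub (hKN.first (h0 hK) hc hz)) hd hd'
    · exact P.det2_pos_of_corner hL hM hN hag hag' hp hx hy hz hd hd'
  · exact ⟨j, hj, fun l hl => (hag l (hl.trans h)).trans (hag' l hl), p', y', z,
      (hag (j - 1) (by omega)).trans hp', (hag j h).trans hy', hz, hd'⟩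

/-- Transitivity axiom for geodesic order types: points to the left of the
geodesic `ab` are in transitive radial order around `a`. -/
theorem geodesic_transitivity
    (P : SimplePolygon) (a b u v w : Pt)
    (ha : a ∈ P.interior) (hb : b ∈ P.interior)
    (hu : u ∈ P.interior) (hv : v ∈ P.interior) (hw : w ∈ P.interior)
    (hab : a ≠ b) (hau : a ≠ u) (hav : a ≠ v) (haw : a ≠ w)
    (hbu : b ≠ u) (hbv : b ≠ v) (hbw : b ≠ w)
    (huv : u ≠ v) (huw : u ≠ w) (hvw : v ≠ w)
    (hgp : StrongGenPos (({a, b, u, v, w} : Set Pt) ∪ P.vertexSet))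
    (h1 : geodesicCCW P a b u) (h2 : geodesicCCW P a b v) (h3 : geodesicCCW P a b w)
    (h4 : geodesicCCW P a u v) (h5 : geodesicCCW P a v w) :
    geodesicCCW P a u w := by
  obtain ⟨K, L, hK, hL, -⟩ := id h1
  obtain ⟨M, N, hM, hN, -⟩ := id h5
  have hK' := hK.isShortest
  have hL' := hL.isShortest
  have hM' := hM.isShortest
  have hN' := hN.isShortest
  obtain ⟨k₁, hKL⟩ := h1.exists_leavesLeft hK' hL'
  obtain ⟨k₂, hKM⟩ := h2.exists_leavesLeft hK' hM'
  obtain ⟨k₃, hKN⟩ := h3.exists_leavesLeft hK' hN'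
  obtain ⟨i, hLM⟩ := h4.exists_leavesLeft hL' hM'
  obtain ⟨j, hMN⟩ := h5.exists_leavesLeft hM' hN'
  obtain ⟨l, h⟩ := P.leavesLeft_trans hK' hL' hM' hN' hKL hKM hKN hLM hMN
  exact ⟨L, N, hL, hN, l, h.1, h.2.1, h.getElem?_ne, h.2.2⟩
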